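/- arXiv:2006.07715 — 3 statements merged into one kernel-verified Lean document; each statement's English description precedes it below -/
import Mathlib

section
/- Let X be a generating, cogenerating, functorially finite full subcategory of an abelian category A satisfying (d-Rigid) for some d > 1, and let f : X₁ → X₀ be a morphism in X that is a weak cokernel (of some morphism of X). Then Ext¹_A(Coker f, X) = 0 for all X ∈ X. -/
open CategoryTheory CategoryTheory.Limits

universe w v u

variable {A : Type u} [Category.{v} A] [Abelian A]

/-- `k : a ⟶ b` is a weak kernel of `f : b ⟶ c` relative to the full subcategory `X`. -/
def IsWeakKernelIn (X : Set A) {a b c : A} (k : a ⟶ b) (f : b ⟶ c) : Prop :=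
  k ≫ f = 0 ∧ ∀ ⦃t : A⦄, t ∈ X → ∀ l : t ⟶ b, l ≫ f = 0 → ∃ m : t ⟶ a, m ≫ k = l

/-- `h : b ⟶ c` is a weak cokernel of `k : a ⟶ b` relative to the full subcategory `X`. -/
def IsWeakCokernelIn (X : Set A) {a b c : A} (h : b ⟶ c) (k : a ⟶ b) : Prop :=
  k ≫ h = 0 ∧ ∀ ⦃t : A⦄, t ∈ X → ∀ l : b ⟶ t, k ≫ l = 0 → ∃ m : c ⟶ t, h ≫ m = l

/-- `g : x ⟶ a` is a right `X`-approximation of `a`. -/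
def IsRightApprox (X : Set A) {x a : A} (g : x ⟶ a) : Prop :=
  x ∈ X ∧ ∀ ⦃t : A⦄, t ∈ X → ∀ h : t ⟶ a, ∃ k : t ⟶ x, k ≫ g = h

/-- `g : a ⟶ x` is a left `X`-approximation of `a`. -/
def IsLeftApprox (X : Set A) {a x : A} (g : a ⟶ x) : Prop :=
  x ∈ X ∧ ∀ ⦃t : A⦄, t ∈ X → ∀ h : a ⟶ t, ∃ k : x ⟶ t, g ≫ k = h

/-- `X` is a generating subcategory: every object is a quotient of an object of `X`. -/
def Generating (X : Set A) : Prop := ∀ a : A, ∃ x ∈ X, ∃ p : x ⟶ a, Epi p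

/-- `X` is a cogenerating subcategory: every object embeds into an object of `X`. -/
def Cogenerating (X : Set A) : Prop := ∀ a : A, ∃ x ∈ X, ∃ i : a ⟶ x, Mono i

/-- Every object admits a right `X`-approximation. -/
def ContravariantlyFinite (X : Set A) : Prop :=
  ∀ a : A, ∃ (x : A) (g : x ⟶ a), IsRightApprox X g

/-- Every object admits a left `X`-approximation. -/
def CovariantlyFinite (X : Set A) : Prop :=
  ∀ a : A, ∃ (x : A) (g : a ⟶ x), IsLeftApprox X g

/-- `X` is functorially finite. -/
def FunctoriallyFinite (X : Set A) : Prop :=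
  ContravariantlyFinite X ∧ CovariantlyFinite X

/-- The (d-Rigid) axiom: every epimorphism `f₁ : X₁ ⟶ X₀` of `X` extends to a sequence
`X_{d+1} ⟶ X_d ⟶ ⋯ ⟶ X₁ ⟶ X₀` with `f_{i+1}` a weak kernel of `f_i` and `f_i` a
weak cokernel of `f_{i+1}` for `1 ≤ i ≤ d`. -/
def DRigid (X : Set A) (d : ℕ) : Prop :=
  ∀ ⦃x₁ x₀ : A⦄, x₁ ∈ X → x₀ ∈ X → ∀ f : x₁ ⟶ x₀, Epi f →
    ∃ (Y : ℕ → A) (g : ∀ i, Y (i + 1) ⟶ Y i) (hY0 : Y 0 = x₀) (hY1 : Y 1 = x₁),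
      (∀ i ≤ d + 1, Y i ∈ X) ∧
      g 0 = eqToHom hY1 ≫ f ≫ eqToHom hY0.symm ∧
      ∀ i < d, IsWeakKernelIn X (g (i + 1)) (g i) ∧ IsWeakCokernelIn X (g i) (g (i + 1))

open HomologicalComplex in
/-- A quasi-isomorphism from a complex in degrees `≤ i` to a complex concentrated in degree `i`
is an epimorphism in degree `i`. -/
lemma CochainComplex.epi_f_of_quasiIsoAt {K : CochainComplex A ℤ} {Z : A} {i : ℤ}
    (π : K ⟶ (HomologicalComplex.single A (ComplexShape.up ℤ) i).obj Z) [K.IsStrictlyLE i]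
    [QuasiIsoAt π i] : Epi (π.f i) := by
  have hK : IsIso (K.iCycles i) := K.isIso_iCycles i (i + 1) (by simp)
    ((K.isZero_of_isStrictlyLE i (i + 1) (by simp)).eq_of_tgt _ _)
  have : Epi (cyclesMap π i) := by
    have h := homologyπ_naturality π i
    have : Epi (cyclesMap π i ≫ homologyπ _ i) := by rw [← h]; infer_instance
    have : IsIso (homologyπ ((single A (ComplexShape.up ℤ) i).obj Z) i) :=
      isIso_homologyπ _ (i - 1) i (by simp) (by simp)
    have : cyclesMap π i = (cyclesMap π i ≫ homologyπ _ i) ≫ inv (homologyπ _ i) := by simp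
    rw [this]
    exact epi_comp _ _
  have : IsIso (iCycles ((single A (ComplexShape.up ℤ) i).obj Z) i) :=
    isIso_iCycles _ i (i + 1) (by simp) (by simp)
  have h : π.f i = inv (K.iCycles i) ≫ cyclesMap π i ≫ iCycles _ i := by simp
  rw [h]
  infer_instance

open HomologicalComplex in
/-- A quasi-isomorphism to a complex concentrated in degree `i` from a complex in degrees `≤ i`
can be lifted along some epimorphism. -/
lemma CochainComplex.exists_epi_single_map_eq_comp {K : CochainComplex A ℤ} {Z : A} {i : ℤ}
    (π : K ⟶ (single A (ComplexShape.up ℤ) i).obj Z) [K.IsStrictlyLE i] [hπ : QuasiIsoAt π i] :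
    ∃ (Y : A) (p : Y ⟶ Z) (σ : (single A (ComplexShape.up ℤ) i).obj Y ⟶ K),
      Epi p ∧ (single A (ComplexShape.up ℤ) i).map p = σ ≫ π := by
  have := CochainComplex.epi_f_of_quasiIsoAt π
  refine ⟨K.X i, π.f i ≫ (singleObjXSelf (ComplexShape.up ℤ) i Z).hom, mkHomFromSingle (𝟙 _) ?_,
    epi_comp _ _, ?_⟩
  · rintro _ rfl
    apply (K.isZero_of_isStrictlyLE i (i + 1) (by simp)).eq_of_tgt
  · apply from_single_hom_ext
    rw [comp_f, mkHomFromSingle_f, single_map_f_self]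
    simp

open DerivedCategory in
/-- A morphism in the derived category from an object in degree `i` to a complex in degrees `< i`
is killed by precomposition with some epimorphism. -/
lemma DerivedCategory.exists_epi_singleFunctor_map_comp_eq_zero [HasDerivedCategory.{w} A] {Z : A}
    {L : CochainComplex A ℤ} {i : ℤ}
    (φ : Q.obj ((CochainComplex.singleFunctor A i).obj Z) ⟶ Q.obj L)
    (n : ℤ) (hn : n < i) [L.IsStrictlyLE n] :
    ∃ (Y : A) (p : Y ⟶ Z), Epi p ∧ Q.map ((CochainComplex.singleFunctor A i).map p) ≫ φ = 0 := by
  obtain ⟨K, _, π, h, g, rfl⟩ := right_fac_of_isStrictlyLE φ i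
  have hqi : QuasiIso π := by rwa [isIso_Q_map_iff_quasiIso] at h
  obtain ⟨Y, p, σ, hp, hσ⟩ :
      ∃ (Y : A) (p : Y ⟶ Z) (σ : (CochainComplex.singleFunctor A i).obj Y ⟶ K),
        Epi p ∧ (CochainComplex.singleFunctor A i).map p = σ ≫ π :=
    CochainComplex.exists_epi_single_map_eq_comp (hπ := hqi.quasiIsoAt i)
  have hg : σ ≫ g = 0 := by
    apply HomologicalComplex.from_single_hom_ext
    apply (L.isZero_of_isStrictlyLE n i hn).eq_of_tgt
  refine ⟨Y, p, hp, ?_⟩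
  rw [hσ, Q.map_comp, Category.assoc, IsIso.hom_inv_id_assoc, ← Q.map_comp, hg, Q.map_zero]

namespace CategoryTheory.Abelian.Ext

open _root_.DerivedCategory in
/-- Every `Ext`-class of positive degree is killed by pullback along some epimorphism. -/
lemma exists_epi_mk₀_comp_eq_zero [HasExt.{w} A] {Z x : A} {n : ℕ} (e : Ext Z x (n + 1)) :
    ∃ (Y : A) (p : Y ⟶ Z), Epi p ∧ (mk₀ p).comp e (zero_add _) = 0 := by
  let := HasDerivedCategory.standard A
  obtain ⟨Y, p, hp, h⟩ := exists_epi_singleFunctor_map_comp_eq_zero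
    (L := (CochainComplex.singleFunctor A (-(n + 1))).obj x) (n := -(n + 1)) (i := 0)
    (e.hom ≫ ((singleFunctors A).shiftIso (n + 1) (-(n + 1)) 0 (by lia)).hom.app _) (by lia)
  refine ⟨Y, p, hp, homEquiv.injective ?_⟩
  change ((mk₀ p).comp e (zero_add _)).hom = (0 : Ext Y x (n + 1)).hom
  rw [← singleFunctor_map_comp_hom, zero_hom,
    ← cancel_mono (((singleFunctors A).shiftIso (n + 1) (-(n + 1)) 0 (by lia)).hom.app _),
    Limits.zero_comp, Category.assoc]
  exact h

/-- A class in `Ext¹(S.X₃, x)` that vanishes on `S.X₂` is zero if every morphism `S.X₁ ⟶ x`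
extends along `S.f`. -/
lemma eq_zero_of_forall_exists_fac [HasExt.{w} A] {S : ShortComplex A} (hS : S.ShortExact) {x : A}
    (hx : ∀ l : S.X₁ ⟶ x, ∃ m : S.X₂ ⟶ x, S.f ≫ m = l) (e : Ext S.X₃ x 1)
    (he : (mk₀ S.g).comp e (zero_add 1) = 0) : e = 0 := by
  obtain ⟨y, rfl⟩ := contravariant_sequence_exact₃ hS x e he (n₀ := 0) rfl
  obtain ⟨l, rfl⟩ := (mk₀_bijective _ _).surjective y
  obtain ⟨m, rfl⟩ := hx l
  rw [← mk₀_comp_mk₀, hS.extClass_comp_assoc]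

end CategoryTheory.Abelian.Ext

/-- A weak kernel relative to a generating subcategory is exact in the middle. -/
lemma IsWeakKernelIn.exact {X : Set A} (hgen : Generating X) {a b c : A} {k : a ⟶ b} {f : b ⟶ c}
    (h : IsWeakKernelIn X k f) : (ShortComplex.mk k f h.1).Exact := by
  obtain ⟨t, ht, q, hq⟩ := hgen (kernel f)
  obtain ⟨m, hm⟩ := h.2 ht (q ≫ kernel.ι f) (by simp)
  rw [ShortComplex.exact_iff_epi_kernel_lift]
  have : m ≫ kernel.lift f k h.1 = q := by simp [← cancel_mono (kernel.ι f), hm]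
  have : Epi (m ≫ kernel.lift f k h.1) := by rwa [this]
  exact epi_of_epi m _

open CategoryTheory.Abelian in
/-- If `X` is generating and satisfies (d-Rigid) for some `d > 1`, then `Ext¹` vanishes on `X`. -/
lemma DRigid.ext_one_eq_zero [HasExt.{w} A] {X : Set A} {d : ℕ} (hrigid : DRigid X d) (hd : 1 < d)
    (hgen : Generating X) {z x : A} (hz : z ∈ X) (hx : x ∈ X) (e : Ext z x 1) : e = 0 := by
  obtain ⟨Y', p, hp, hpe⟩ := e.exists_epi_mk₀_comp_eq_zero
  obtain ⟨y, hy, q, hq⟩ := hgen Y'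
  obtain ⟨Y, g, rfl, rfl, -, hg0, hg⟩ := hrigid hy hz (q ≫ p) (epi_comp q p)
  replace hg0 : g 0 = q ≫ p := by simpa using hg0
  have hg0_epi : Epi (g 0) := by rw [hg0]; exact epi_comp q p
  have hex := (hg 0 (by lia)).1.exact hgen
  have : Epi (kernel.lift (g 0) (g 1) (hg 0 (by lia)).1.1) :=
    ((ShortComplex.mk _ _ _).exact_iff_epi_kernel_lift).1 hex
  refine Ext.eq_zero_of_forall_exists_fac
    (S := ShortComplex.mk (kernel.ι (g 0)) (g 0) (kernel.condition _))
    { exact := ShortComplex.exact_kernel (g 0) } (fun l ↦ ?_) e ?_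
  · obtain ⟨m, hm⟩ := (hg 1 hd).2.2 hx (kernel.lift (g 0) (g 1) (hg 0 (by lia)).1.1 ≫ l) (by
      have : g 2 ≫ kernel.lift (g 0) (g 1) (hg 0 (by lia)).1.1 = 0 := by
        rw [← cancel_mono (kernel.ι (g 0)), Category.assoc, kernel.lift_ι, zero_comp]
        exact (hg 1 hd).1.1
      exact by rw [reassoc_of% this, zero_comp])
    refine ⟨m, ?_⟩
    rw [← cancel_epi (kernel.lift (g 0) (g 1) (hg 0 (by lia)).1.1), ← hm, kernel.lift_ι_assoc]
  · change (Ext.mk₀ (g 0)).comp e _ = 0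
    rw [hg0, ← Ext.mk₀_comp_mk₀_assoc, hpe, Ext.comp_zero]

/-- If `X` is generating, cogenerating, functorially finite, satisfies (d-Rigid) for
some `d > 1`, and `f : X₁ ⟶ X₀` in `X` is a weak cokernel, then
`Ext¹(Coker f, X) = 0` for all `X ∈ X`. -/
theorem ext_one_coker_vanishes [CategoryTheory.HasExt.{w} A] (X : Set A) (d : ℕ) (hd : 1 < d)
    (hgen : Generating X) (hcog : Cogenerating X) (hff : FunctoriallyFinite X)
    (hrigid : DRigid X d)
    {x₁ x₀ : A} (h₁ : x₁ ∈ X) (h₀ : x₀ ∈ X) (f : x₁ ⟶ x₀)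
    {x₂ : A} (h₂ : x₂ ∈ X) (g : x₂ ⟶ x₁) (hwc : IsWeakCokernelIn X f g) :
    ∀ x ∈ X, Subsingleton (CategoryTheory.Abelian.Ext (cokernel f) x 1) := by
  intro x hx
  refine subsingleton_of_forall_eq 0 fun e ↦ ?_
  have hS : (ShortComplex.mk (Abelian.image.ι f) (cokernel.π f)
      (kernel.condition (cokernel.π f))).ShortExact :=
    { exact := ShortComplex.exact_kernel (cokernel.π f) }
  refine Abelian.Ext.eq_zero_of_forall_exists_fac hS (fun l ↦ ?_) e
    (hrigid.ext_one_eq_zero hd hgen h₀ hx _)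
  have hgf : g ≫ Abelian.factorThruImage f = 0 := by
    rw [← cancel_mono (Abelian.image.ι f), Category.assoc, Abelian.image.fac, zero_comp, hwc.1]
  obtain ⟨m, hm⟩ := hwc.2 hx (Abelian.factorThruImage f ≫ l) (by
    rw [reassoc_of% hgf, zero_comp])
  refine ⟨m, ?_⟩
  rw [← cancel_epi (Abelian.factorThruImage f), ← hm]
  rw [← Category.assoc, Abelian.image.fac]
end

section
/- Let X be a generating, cogenerating, functorially finite full subcategory of an abelian category A and let d ≥ 1. Then X satisfies (d-Rigid) if and only if Ext^i_A(X, X') = 0 for all X, X' ∈ X and all 0 < i < d. -/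
open CategoryTheory CategoryTheory.Limits

universe w v u

variable {A : Type u} [Category.{v} A] [Abelian A]

open HomologicalComplex in
/-- A map `s` to a complex concentrated in degree `i` which induces an isomorphism on `H^i`
becomes a map induced by an epimorphism after restriction to the cycles of its source. -/
lemma exists_epi_single_map_eq {L : A} {K : CochainComplex A ℤ} {i : ℤ}
    (s : K ⟶ (single A (ComplexShape.up ℤ) i).obj L) [QuasiIsoAt s i] :
    ∃ (E : A) (p : E ⟶ L) (_ : Epi p) (t : (single A (ComplexShape.up ℤ) i).obj E ⟶ K),
      t ≫ s = (single A (ComplexShape.up ℤ) i).map p := by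
  let p : K.cycles i ⟶ L :=
    K.homologyπ i ≫ homologyMap s i ≫ (singleObjHomologySelfIso _ _ _).hom
  have hp : K.iCycles i ≫ s.f i = p ≫ (singleObjXSelf (ComplexShape.up ℤ) i L).inv := by
    dsimp only [p]
    rw [Category.assoc, Category.assoc, homologyπ_naturality_assoc,
      homologyπ_singleObjHomologySelfIso_hom_assoc,
      ← singleObjCyclesSelfIso_inv_iCycles, Iso.hom_inv_id_assoc, ← cyclesMap_i]
  have : Epi p := inferInstanceAs
    (Epi (K.homologyπ i ≫ homologyMap s i ≫ (singleObjHomologySelfIso _ _ _).hom))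
  refine ⟨K.cycles i, p, this, mkHomFromSingle (K.iCycles i) (fun j _ ↦ by simp), ?_⟩
  apply from_single_hom_ext
  rw [comp_f, mkHomFromSingle_f, Category.assoc, hp, single_map_f_self]

open DerivedCategory HomologicalComplex in
lemma exists_epi_Q_map_single_map_comp_eq_zero [HasDerivedCategory.{w} A] {L Z : A} {i j : ℤ}
    (hij : i ≠ j) (φ : Q.obj ((single A (ComplexShape.up ℤ) i).obj L) ⟶
      Q.obj ((single A (ComplexShape.up ℤ) j).obj Z)) :
    ∃ (E : A) (p : E ⟶ L), Epi p ∧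
      Q.map ((single A (ComplexShape.up ℤ) i).map p) ≫ φ = 0 := by
  obtain ⟨K, s, hs, g, rfl⟩ := right_fac φ
  have : QuasiIso s := by rwa [isIso_Q_map_iff_quasiIso] at hs
  obtain ⟨E, p, hp, t, ht⟩ := exists_epi_single_map_eq s
  have htg : t ≫ g = 0 :=
    from_single_hom_ext ((isZero_single_obj_X _ _ _ _ hij).eq_of_tgt _ _)
  refine ⟨E, p, hp, ?_⟩
  rw [← ht, Q.map_comp, Category.assoc, IsIso.hom_inv_id_assoc, ← Q.map_comp, htg, Q.map_zero]

open DerivedCategory in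
/-- `Ext` in positive degrees is effaceable in the first variable. -/
lemma CategoryTheory.Abelian.Ext.exists_epi_mk₀_comp_eq_zero_s16 [HasExt.{w} A] {L Z : A} {n : ℕ}
    (e : Abelian.Ext L Z (n + 1)) :
    ∃ (E : A) (p : E ⟶ L), Epi p ∧ (Abelian.Ext.mk₀ p).comp e (zero_add _) = 0 := by
  let := HasDerivedCategory.standard A
  let sh := ((singleFunctors A).shiftIso ((n + 1 : ℕ) : ℤ) (-((n + 1 : ℕ) : ℤ)) 0
    (by lia)).app Z
  obtain ⟨E, p, hp, h⟩ := exists_epi_Q_map_single_map_comp_eq_zero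
    (i := 0) (j := -((n + 1 : ℕ) : ℤ)) (by lia) (e.hom ≫ sh.hom)
  refine ⟨E, p, hp, ?_⟩
  apply Abelian.Ext.ext
  rw [Abelian.Ext.comp_hom, Abelian.Ext.mk₀_hom, ShiftedHom.mk₀_comp, Abelian.Ext.zero_hom,
    ← cancel_mono sh.hom, Limits.zero_comp, Category.assoc]
  exact h

/-- `k` and `f` compose to zero and are exact at the middle object. -/
def IsExactPair {a b c : A} (k : a ⟶ b) (f : b ⟶ c) : Prop :=
  ∃ w : k ≫ f = 0, (ShortComplex.mk k f w).Exact

lemma IsExactPair.epi_kernel_lift {a b c : A} {k : a ⟶ b} {f : b ⟶ c} (h : IsExactPair k f) :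
    Epi (kernel.lift f k h.1) :=
  (ShortComplex.mk k f h.1).exact_iff_epi_kernel_lift.1 h.2

lemma IsExactPair.comp_kernel_lift {a b c e : A} {j : e ⟶ a} {k : a ⟶ b} {f : b ⟶ c}
    (h : IsExactPair j k) (w : k ≫ f = 0) : IsExactPair j (kernel.lift f k w) := by
  have w' : j ≫ kernel.lift f k w = 0 := by
    rw [← cancel_mono (kernel.ι f)]
    simpa using h.1
  refine ⟨w', ?_⟩
  let φ : ShortComplex.mk j (kernel.lift f k w) w' ⟶ ShortComplex.mk j k h.1 :=
    { τ₁ := 𝟙 _, τ₂ := 𝟙 _, τ₃ := kernel.ι f }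
  have : Epi φ.τ₁ := inferInstanceAs (Epi (𝟙 e))
  have : IsIso φ.τ₂ := inferInstanceAs (IsIso (𝟙 a))
  have : Mono φ.τ₃ := inferInstanceAs (Mono (kernel.ι f))
  exact (ShortComplex.exact_iff_of_epi_of_isIso_of_mono φ).2 h.2

/-- A morphism killed by `j` factors through the epimorphism `k` when `j` and `k` form an exact pair. -/
lemma IsExactPair.exists_comp_eq {a b c z : A} {j : a ⟶ b} {k : b ⟶ c}
    (h : IsExactPair j k) [Epi k] (l : b ⟶ z) (hl : j ≫ l = 0) : ∃ m : c ⟶ z, k ≫ m = l :=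
  have : Epi (ShortComplex.mk j k h.1).g := ‹Epi k›
  ⟨h.2.desc l hl, h.2.g_desc l hl⟩

lemma shortExact_kernel {b c : A} (p : b ⟶ c) [Epi p] :
    (ShortComplex.mk (kernel.ι p) p (kernel.condition p)).ShortExact where
  exact := ShortComplex.exact_of_f_is_kernel _ (kernelIsKernel p)

section Resolution

variable [CategoryTheory.HasExt.{w} A] {Z : A}

open CategoryTheory.Abelian

/-- If `Ext¹(c, Z) = 0`, then every morphism from the kernel of `p : b ⟶ c` to `Z` extends
to `b`. -/
lemma exists_kernel_ι_comp_eq {b c : A} (p : b ⟶ c) [Epi p] [Subsingleton (Ext c Z 1)]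
    (l : kernel p ⟶ Z) : ∃ m : b ⟶ Z, kernel.ι p ≫ m = l := by
  obtain ⟨x, hx⟩ := Ext.contravariant_sequence_exact₁ (shortExact_kernel p) Z (Ext.mk₀ l)
    (add_zero 1) (Subsingleton.elim _ _)
  obtain ⟨m, rfl⟩ := Ext.mk₀_bijective _ _ |>.2 x
  exact ⟨m, (Ext.mk₀_bijective _ _).1 (by simpa using hx)⟩

lemma subsingleton_ext_kernel {b c : A} (p : b ⟶ c) [Epi p] (n : ℕ)
    [Subsingleton (Ext b Z n)] [Subsingleton (Ext c Z (n + 1))] :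
    Subsingleton (Ext (kernel p) Z n) := by
  refine subsingleton_of_forall_eq 0 fun x ↦ ?_
  obtain ⟨y, rfl⟩ := Ext.contravariant_sequence_exact₁ (shortExact_kernel p) Z x
    (add_comm 1 n) (Subsingleton.elim _ _)
  rw [Subsingleton.elim y 0, Ext.comp_zero]

/-- In a partial resolution `Y` of `L` whose terms have no higher extensions with `Z`, the
vanishing of `Ext^{n+1}(L, Z)` gives exactness of `Hom(Y, Z)` in degree `n + 1`. -/
lemma exists_comp_eq_of_subsingleton_ext (n : ℕ) : ∀ {L : A} (Y : ℕ → A)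
    (g : ∀ i, Y (i + 1) ⟶ Y i) (p : Y 0 ⟶ L), Epi p → IsExactPair (g 0) p →
    (∀ i ≤ n, IsExactPair (g (i + 1)) (g i)) →
    (∀ i ≤ n, ∀ j, 0 < j → j ≤ n → Subsingleton (Ext (Y i) Z j)) →
    Subsingleton (Ext L Z (n + 1)) →
    ∀ l : Y (n + 1) ⟶ Z, g (n + 1) ≫ l = 0 → ∃ m : Y n ⟶ Z, g n ≫ m = l := by
  induction n with
  | zero =>
    intro L Y g p _ hp hg _ hL l hl
    have := hp.epi_kernel_lift
    obtain ⟨m, rfl⟩ :=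
      ((hg 0 le_rfl).comp_kernel_lift hp.1).exists_comp_eq l hl
    obtain ⟨m, rfl⟩ := exists_kernel_ι_comp_eq p m
    exact ⟨m, by simp⟩
  | succ n ih =>
    intro L Y g p _ hp hg hY hL
    have := hY 0 (by lia) (n + 1) (by lia) le_rfl
    exact ih (fun i ↦ Y (i + 1)) (fun i ↦ g (i + 1)) (kernel.lift p (g 0) hp.1)
      hp.epi_kernel_lift ((hg 0 (by lia)).comp_kernel_lift hp.1)
      (fun i hi ↦ hg (i + 1) (by lia)) (fun i hi j h₀ h₁ ↦ hY _ (by lia) j h₀ (by lia))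
      (subsingleton_ext_kernel p _)

/-- In a partial resolution `Y` of `L` whose terms have no higher extensions with `Z`,
exactness of `Hom(Y, Z)` in degree `n + 1` shows that every class in `Ext^{n+1}(L, Z)` which
vanishes on `Y 0` is zero. -/
lemma ext_eq_zero_of_exists_comp_eq (n : ℕ) : ∀ {L : A} (Y : ℕ → A)
    (g : ∀ i, Y (i + 1) ⟶ Y i) (p : Y 0 ⟶ L), Epi p → IsExactPair (g 0) p →
    (∀ i ≤ n, IsExactPair (g (i + 1)) (g i)) →
    (∀ i ≤ n, ∀ j, 0 < j → j ≤ n → Subsingleton (Ext (Y i) Z j)) →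
    (∀ l : Y (n + 1) ⟶ Z, g (n + 1) ≫ l = 0 → ∃ m : Y n ⟶ Z, g n ≫ m = l) →
    ∀ e : Ext L Z (n + 1), (Ext.mk₀ p).comp e (zero_add _) = 0 → e = 0 := by
  induction n with
  | zero =>
    intro L Y g p _ hp hg _ hl e he
    have := hp.epi_kernel_lift
    obtain ⟨x, rfl⟩ := Ext.contravariant_sequence_exact₃ (shortExact_kernel p) Z e he
      (add_zero 1)
    obtain ⟨f, rfl⟩ := Ext.mk₀_bijective _ _ |>.2 x
    obtain ⟨m, hm⟩ := hl (kernel.lift p (g 0) hp.1 ≫ f) (by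
      rw [← Category.assoc, ((hg 0 le_rfl).comp_kernel_lift hp.1).1, zero_comp])
    obtain rfl : kernel.ι p ≫ m = f := by
      rw [← cancel_epi (kernel.lift p (g 0) hp.1), ← hm, kernel.lift_ι_assoc]
    rw [← Ext.mk₀_comp_mk₀]
    exact (shortExact_kernel p).extClass_comp_assoc _
  | succ n ih =>
    intro L Y g p _ hp hg hY hl e he
    have := hY 1 (by lia) (n + 1) (by lia) le_rfl
    obtain ⟨x, rfl⟩ := Ext.contravariant_sequence_exact₃ (shortExact_kernel p) Z e he
      (add_comm 1 (n + 1))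
    rw [ih (fun i ↦ Y (i + 1)) (fun i ↦ g (i + 1)) (kernel.lift p (g 0) hp.1)
      hp.epi_kernel_lift ((hg 0 (by lia)).comp_kernel_lift hp.1)
      (fun i hi ↦ hg (i + 1) (by lia)) (fun i hi j h₀ h₁ ↦ hY _ (by lia) j h₀ (by lia))
      hl x (Subsingleton.elim _ _), Ext.comp_zero]

end Resolution

lemma IsWeakKernelIn.isExactPair {X : Set A} (hgen : Generating X) {a b c : A} {k : a ⟶ b}
    {f : b ⟶ c} (h : IsWeakKernelIn X k f) : IsExactPair k f := by
  refine ⟨h.1, (ShortComplex.mk k f h.1).exact_iff_epi_kernel_lift.2 ?_⟩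
  obtain ⟨t, ht, q, _⟩ := hgen (kernel f)
  obtain ⟨m, hm⟩ := h.2 ht (q ≫ kernel.ι f) (by simp)
  have : m ≫ kernel.lift f k h.1 = q := by
    rw [← cancel_mono (kernel.ι f)]
    simpa using hm
  exact epi_of_epi_fac this

lemma ContravariantlyFinite.exists_isWeakKernelIn {X : Set A} (h : ContravariantlyFinite X)
    {b c : A} (f : b ⟶ c) : ∃ a ∈ X, ∃ k : a ⟶ b, IsWeakKernelIn X k f := by
  obtain ⟨a, r, ha, hr⟩ := h (kernel f)
  refine ⟨a, ha, r ≫ kernel.ι f, by simp, fun t ht l hl ↦ ?_⟩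
  obtain ⟨m, hm⟩ := hr ht (kernel.lift f l hl)
  exact ⟨m, by rw [← Category.assoc, hm, kernel.lift_ι]⟩

/-- Iterated weak kernels of a morphism of `X`. -/
lemma ContravariantlyFinite.exists_weakKernel_sequence {X : Set A}
    (h : ContravariantlyFinite X) {x₁ x₀ : A} (h₁ : x₁ ∈ X) (h₀ : x₀ ∈ X) (f : x₁ ⟶ x₀) :
    ∃ (Y : ℕ → A) (g : ∀ i, Y (i + 1) ⟶ Y i) (hY0 : Y 0 = x₀) (hY1 : Y 1 = x₁),
      (∀ i, Y i ∈ X) ∧ g 0 = eqToHom hY1 ≫ f ≫ eqToHom hY0.symm ∧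
      ∀ i, IsWeakKernelIn X (g (i + 1)) (g i) := by
  choose K hK k hk using fun {b c : A} (f : b ⟶ c) ↦ h.exists_isWeakKernelIn f
  let s : ℕ → Arrow A := fun n ↦ n.rec (Arrow.mk f) fun _ a ↦ Arrow.mk (k a.hom)
  refine ⟨fun i ↦ (s i).right, fun i ↦ ?_, rfl, rfl, ?_, ?_, ?_⟩
  · exact (s i).hom
  · rintro (_ | _ | i)
    exacts [h₀, h₁, hK _]
  · simp [s]
  · exact fun i ↦ hk (s i).hom

/-- A generating cogenerating functorially finite subcategory `X` of an abelian
category satisfies (d-Rigid) if and only if `Ext^i(X, X') = 0` for all `X, X' ∈ X`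
and `0 < i < d`. -/
theorem dRigid_iff_ext_vanishing [CategoryTheory.HasExt.{w} A] (X : Set A) (d : ℕ)
    (hd : 1 ≤ d)
    (hgen : Generating X) (hcog : Cogenerating X) (hff : FunctoriallyFinite X) :
    DRigid X d ↔ ∀ x ∈ X, ∀ x' ∈ X, ∀ i : ℕ, 0 < i → i < d →
      Subsingleton (CategoryTheory.Abelian.Ext x x' i) := by
  constructor
  · intro h
    suffices ∀ n : ℕ, n + 1 < d → ∀ x ∈ X, ∀ x' ∈ X,
        Subsingleton (CategoryTheory.Abelian.Ext x x' (n + 1)) by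
      intro x hx x' hx' i hi hid
      obtain ⟨n, rfl⟩ := Nat.exists_eq_add_of_le' hi
      exact this n hid x hx x' hx'
    intro n
    induction n using Nat.strong_induction_on with
    | _ n ih =>
    intro hn x hx x' hx'
    refine subsingleton_of_forall_eq 0 fun e ↦ ?_
    obtain ⟨E, q, _, hq⟩ := e.exists_epi_mk₀_comp_eq_zero_s16
    obtain ⟨x₁, hx₁, r, _⟩ := hgen E
    obtain ⟨Y, g, rfl, rfl, hY, hg₀, hg⟩ := h hx₁ hx (r ≫ q) inferInstance
    have hp : g 0 = r ≫ q := by simpa using hg₀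
    have hex i (hi : i < d) := (hg i hi).1.isExactPair hgen
    refine ext_eq_zero_of_exists_comp_eq n (fun i ↦ Y (i + 1)) (fun i ↦ g (i + 1)) (g 0)
      (hp ▸ inferInstance) (hex 0 (by lia)) (fun i _ ↦ hex (i + 1) (by lia)) ?_
      (fun l hl ↦ (hg (n + 1) hn).2.2 hx' l hl) e ?_
    · intro i _ j hj _
      obtain ⟨m, rfl⟩ := Nat.exists_eq_add_of_le' hj
      exact ih m (by lia) (by lia) _ (hY _ (by lia)) x' hx'
    · rw [hp, ← CategoryTheory.Abelian.Ext.mk₀_comp_mk₀_assoc, hq,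
        CategoryTheory.Abelian.Ext.comp_zero]
  · intro h x₁ x₀ h₁ h₀ f _
    obtain ⟨Y, g, rfl, rfl, hY, hg₀, hg⟩ := hff.1.exists_weakKernel_sequence h₁ h₀ f
    refine ⟨Y, g, rfl, rfl, fun i _ ↦ hY i, hg₀, fun i hi ↦ ⟨hg i, (hg i).1, ?_⟩⟩
    obtain rfl : g 0 = f := by simpa using hg₀
    have hex i := (hg i).isExactPair hgen
    intro t ht l hl
    obtain _ | n := i
    · exact (hex 0).exists_comp_eq l hl
    · exact exists_comp_eq_of_subsingleton_ext n (fun i ↦ Y (i + 1)) (fun i ↦ g (i + 1)) (g 0)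
        inferInstance (hex 0) (fun i _ ↦ hex (i + 1))
        (fun i _ j h₀ h₁ ↦ h _ (hY _) t ht j h₀ (by lia))
        (h _ (hY 0) t ht (n + 1) (by lia) hi) l hl
end

section
/- Let X be a generating, cogenerating, functorially finite full subcategory of an abelian category A with Ext^i_A(X,X') = 0 for all X, X' ∈ X and 0 < i < d, and suppose X satisfies condition (a) of Definition of d-precluster tilting: for every exact sequence 0 → A' → X_d → ⋯ → X₁ → A → 0 in A with all X_i ∈ X such that each induced map X_i → im f_i is a right X-approximation (1 ≤ i ≤ d), the map A' → X_d is a left X-approximation. Then for every object M ∈ X^{⊥_d} (i.e. Ext^i_A(X, M) = 0 for 0 < i < d and all X ∈ X) one has Ext¹_A(M, X) = 0 for all X ∈ X. -/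
open CategoryTheory CategoryTheory.Limits

universe w v u

variable {A : Type u} [Category.{v} A] [Abelian A]

section ApproximationResolutions

open CategoryTheory.Abelian (Ext)

/-- The objects `⋯ → Y 2 → Y 1 → I → C`. -/
def spliceObj (Y : ℕ → A) (I C : A) : ℕ → A
  | 0 => C
  | 1 => I
  | i + 2 => Y (i + 1)

/-- The morphisms of `⋯ → Y 2 → Y 1 → I → C`, the map `Y 1 → I` being the composite of
`g 0 : Y 1 ⟶ Y 0` and `ι : Y 0 ⟶ I`. -/
def spliceHom {Y : ℕ → A} (g : ∀ i, Y (i + 1) ⟶ Y i) {I C : A} (ι : Y 0 ⟶ I) (π : I ⟶ C) :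
    ∀ i, spliceObj Y I C (i + 1) ⟶ spliceObj Y I C i
  | 0 => π
  | 1 => g 0 ≫ ι
  | i + 2 => g (i + 1)

/-- `0 → Y (n + 1) → Y n → ⋯ → Y 1 → Y 0 → 0` is exact, its middle terms lie in `X`, and each
`Y (i + 1)` is a right `X`-approximation of the image of `g i`, for `i < n`. -/
structure IsApproxResolution (X : Set A) (n : ℕ) (Y : ℕ → A) (g : ∀ i, Y (i + 1) ⟶ Y i) :
    Prop where
  mem : ∀ i, 1 ≤ i → i ≤ n → Y i ∈ X
  epi : Epi (g 0)
  mono : Mono (g n)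
  exact : ∀ i < n, ∃ w : g (i + 1) ≫ g i = 0, (ShortComplex.mk (g (i + 1)) (g i) w).Exact
  approx : ∀ i < n, ∀ ⦃t : A⦄, t ∈ X → ∀ l : t ⟶ image (g i),
    ∃ m : t ⟶ Y (i + 1), m ≫ factorThruImage (g i) = l

/-- Lifting along the epi part of a factorization implies lifting along `factorThruImage`. -/
lemma exists_lift_factorThruImage {t a b c : A} (e : a ⟶ b) (m : b ⟶ c) [Mono m]
    (f : a ⟶ c) (hf : e ≫ m = f) (he : ∀ l : t ⟶ b, ∃ k : t ⟶ a, k ≫ e = l)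
    (l : t ⟶ image f) : ∃ k : t ⟶ a, k ≫ factorThruImage f = l := by
  obtain ⟨k, hk⟩ := he (l ≫ image.lift { I := b, m := m, e := e, fac := hf })
  refine ⟨k, ?_⟩
  rw [← cancel_mono (image.ι f), Category.assoc, image.fac]
  calc k ≫ f = k ≫ e ≫ m := by rw [hf]
    _ = l ≫ image.ι f := by rw [reassoc_of% hk, image.lift_fac]

/-- A short exact sequence whose epimorphism is a right `X`-approximation is an
approximation resolution of length one. -/
lemma isApproxResolution_one (X : Set A) {K I C : A} (ι : K ⟶ I) (π : I ⟶ C) [Mono ι] [Epi π]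
    (w : ι ≫ π = 0) (hex : (ShortComplex.mk ι π w).Exact) (hπ : IsRightApprox X π) :
    IsApproxResolution X 1 (spliceObj (fun _ => K) I C) (spliceHom (fun _ => 𝟙 K) ι π) where
  mem i h₁ h₂ := by
    obtain rfl : i = 1 := by lia
    exact hπ.1
  epi := ‹Epi π›
  mono := mono_comp (𝟙 K) ι
  exact i hi := by
    obtain rfl : i = 0 := by lia
    have key : ∃ w : (𝟙 K ≫ ι) ≫ π = 0, (ShortComplex.mk (𝟙 K ≫ ι) π w).Exact := by
      simpa using ⟨w, hex⟩
    exact key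
  approx i hi t ht := by
    obtain rfl : i = 0 := by lia
    exact exists_lift_factorThruImage π (𝟙 C) _ (Category.comp_id π) (hπ.2 ht)

/-- Splicing an approximation resolution with a short exact sequence `0 → Y 0 → I → C → 0` whose
epimorphism is a right `X`-approximation. -/
lemma IsApproxResolution.splice {X : Set A} {n : ℕ} {Y : ℕ → A} {g : ∀ i, Y (i + 1) ⟶ Y i}
    (h : IsApproxResolution X (n + 1) Y g) {I C : A} (ι : Y 0 ⟶ I) (π : I ⟶ C) [Mono ι] [Epi π]
    (w : ι ≫ π = 0) (hex : (ShortComplex.mk ι π w).Exact) (hπ : IsRightApprox X π) :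
    IsApproxResolution X (n + 2) (spliceObj Y I C) (spliceHom g ι π) where
  mem
    | 0, h₁, _ => by lia
    | 1, _, _ => hπ.1
    | i + 2, _, h₂ => h.mem (i + 1) (by lia) (by lia)
  epi := ‹Epi π›
  mono := h.mono
  exact
    | 0, _ => by
      have := h.epi
      refine ⟨show (g 0 ≫ ι) ≫ π = 0 by rw [Category.assoc, w, comp_zero], ?_⟩
      let φ : ShortComplex.mk (g 0 ≫ ι) π (by rw [Category.assoc, w, comp_zero]) ⟶
          ShortComplex.mk ι π w := { τ₁ := g 0, τ₂ := 𝟙 _, τ₃ := 𝟙 _ }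
      have : Epi φ.τ₁ := h.epi
      have : IsIso φ.τ₂ := inferInstanceAs (IsIso (𝟙 I))
      have : Mono φ.τ₃ := inferInstanceAs (Mono (𝟙 C))
      exact (ShortComplex.exact_iff_of_epi_of_isIso_of_mono φ).2 hex
    | 1, _ => by
      obtain ⟨w', hex'⟩ := h.exact 0 (by lia)
      have w'' : g 1 ≫ g 0 ≫ ι = 0 := by rw [← Category.assoc, w', zero_comp]
      refine ⟨w'', ?_⟩
      let φ : ShortComplex.mk (g 1) (g 0) w' ⟶ ShortComplex.mk (g 1) (g 0 ≫ ι) w'' :=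
        { τ₁ := 𝟙 _, τ₂ := 𝟙 _, τ₃ := ι }
      have : Epi φ.τ₁ := inferInstanceAs (Epi (𝟙 (Y 2)))
      have : IsIso φ.τ₂ := inferInstanceAs (IsIso (𝟙 (Y 1)))
      have : Mono φ.τ₃ := ‹Mono ι›
      exact (ShortComplex.exact_iff_of_epi_of_isIso_of_mono φ).1 hex'
    | i + 2, hi => h.exact (i + 1) (by lia)
  approx
    | 0, _ => fun t ht => exists_lift_factorThruImage π (𝟙 C) _ (Category.comp_id π) (hπ.2 ht)
    | 1, _ => fun t ht => by
      have := h.epi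
      have : Epi (image.ι (g 0)) := epi_of_epi_fac (image.fac (g 0))
      have : IsIso (image.ι (g 0)) := isIso_of_mono_of_epi _
      refine exists_lift_factorThruImage (g 0) ι _ rfl fun l => ?_
      obtain ⟨k, hk⟩ := h.approx 0 (by lia) ht (l ≫ inv (image.ι (g 0)))
      refine ⟨k, ?_⟩
      calc k ≫ g 0 = k ≫ factorThruImage (g 0) ≫ image.ι (g 0) := by rw [image.fac]
        _ = l := by rw [reassoc_of% hk, IsIso.inv_hom_id, Category.comp_id]
    | i + 2, hi => h.approx (i + 1) (by lia)

/-- If `Ext¹(t, S.X₁) = 0`, every morphism `t ⟶ S.X₃` lifts along `S.g`. -/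
lemma exists_lift_of_subsingleton_ext [HasExt.{w} A] {S : ShortComplex A} (hS : S.ShortExact)
    {t : A} (ht : Subsingleton (Ext t S.X₁ 1)) (l : t ⟶ S.X₃) : ∃ k : t ⟶ S.X₂, k ≫ S.g = l := by
  obtain ⟨x, hx⟩ := Ext.covariant_sequence_exact₃ t hS (Ext.mk₀ l) (zero_add 1)
    (Subsingleton.elim _ _)
  obtain ⟨k, rfl⟩ := (Ext.mk₀_bijective _ _).2 x
  exact ⟨k, (Ext.mk₀_bijective _ _).1 (by rw [← Ext.mk₀_comp_mk₀, hx])⟩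

/-- Dimension shifting along a short exact sequence in the covariant variable. -/
lemma subsingleton_ext_of_shortExact [HasExt.{w} A] {S : ShortComplex A} (hS : S.ShortExact)
    {t : A} {i : ℕ} (h₂ : Subsingleton (Ext t S.X₂ i)) (h₁ : Subsingleton (Ext t S.X₁ (i + 1))) :
    Subsingleton (Ext t S.X₃ i) := by
  refine subsingleton_of_forall_eq 0 fun x => ?_
  obtain ⟨y, rfl⟩ := Ext.covariant_sequence_exact₃ t hS x rfl (Subsingleton.elim _ _)
  rw [Subsingleton.elim y 0, Ext.zero_comp]

/-- If `Ext¹(S.X₂, t) = 0` and every morphism `S.X₁ ⟶ t` extends along `S.f`, then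
`Ext¹(S.X₃, t) = 0`. -/
lemma subsingleton_ext_one_of_extends [HasExt.{w} A] {S : ShortComplex A} (hS : S.ShortExact)
    {t : A} (h₂ : Subsingleton (Ext S.X₂ t 1)) (h : ∀ l : S.X₁ ⟶ t, ∃ k : S.X₂ ⟶ t, S.f ≫ k = l) :
    Subsingleton (Ext S.X₃ t 1) := by
  refine subsingleton_of_forall_eq 0 fun x => ?_
  obtain ⟨y, rfl⟩ := Ext.contravariant_sequence_exact₃ hS t x (Subsingleton.elim _ _) (add_zero 1)
  obtain ⟨l, rfl⟩ := (Ext.mk₀_bijective _ _).2 y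
  obtain ⟨k, rfl⟩ := h l
  rw [← Ext.mk₀_comp_mk₀, hS.extClass_comp_assoc]

/-- A right `X`-approximation `p` of an object of `X^{⊥_d}` extends to approximation resolutions
of all lengths up to `d` whose leftmost map is the kernel of `p`. -/
lemma exists_isApproxResolution [HasExt.{w} A] {X : Set A} {d : ℕ} (hcog : Cogenerating X)
    (hext : ∀ x ∈ X, ∀ x' ∈ X, ∀ i : ℕ, 0 < i → i < d → Subsingleton (Ext x x' i))
    {M P : A} (hM : ∀ x ∈ X, ∀ i : ℕ, 0 < i → i < d → Subsingleton (Ext x M i))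
    (p : P ⟶ M) [Epi p] (hp : IsRightApprox X p) (n : ℕ) (hn : n < d) :
    ∃ (Y : ℕ → A) (g : ∀ i, Y (i + 1) ⟶ Y i), IsApproxResolution X (n + 1) Y g ∧
      (∀ x ∈ X, ∀ i : ℕ, 0 < i → i + n < d → Subsingleton (Ext x (Y 0) i)) ∧
      ∀ t, (∀ l : Y (n + 2) ⟶ t, ∃ k : Y (n + 1) ⟶ t, g (n + 1) ≫ k = l) →
        ∀ l : kernel p ⟶ t, ∃ k : P ⟶ t, kernel.ι p ≫ k = l := by
  induction n with
  | zero =>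
    refine ⟨_, _, isApproxResolution_one X (kernel.ι p) p (kernel.condition p)
      (ShortComplex.exact_of_f_is_kernel _ (kernelIsKernel p)) hp, hM, fun t h l => ?_⟩
    obtain ⟨k, hk⟩ := h l
    change (𝟙 _ ≫ kernel.ι p) ≫ k = l at hk
    exact ⟨k, by rwa [Category.id_comp] at hk⟩
  | succ n ih =>
    obtain ⟨Y, g, h, hY, hl⟩ := ih (by lia)
    obtain ⟨I, hI, ι, hι⟩ := hcog (Y 0)
    have hS : (ShortComplex.mk ι (cokernel.π ι) (cokernel.condition ι)).ShortExact :=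
      { exact := ShortComplex.exact_of_g_is_cokernel _ (cokernelIsCokernel ι) }
    refine ⟨_, _, h.splice ι (cokernel.π ι) (cokernel.condition ι) hS.exact ⟨hI, fun t ht =>
      exists_lift_of_subsingleton_ext hS (hY t ht 1 one_pos (by lia))⟩, fun x hx i hi hin => ?_, hl⟩
    exact subsingleton_ext_of_shortExact hS (hext x hx I hI i hi (by lia))
      (hY x hx (i + 1) (by lia) (by lia))

end ApproximationResolutions

/-- Let `X` be generating, cogenerating, functorially finite with `Ext^i(X,X') = 0` for
`0 < i < d`, satisfying condition (a) of the definition of `d`-precluster tilting.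
Then every `M` with `Ext^i(X, M) = 0` for `0 < i < d` satisfies `Ext¹(M, X) = 0`. -/
theorem ext_one_vanishes_of_precluster_condition [CategoryTheory.HasExt.{w} A]
    (X : Set A) (d : ℕ) (hd : 1 < d)
    (hgen : Generating X) (hcog : Cogenerating X) (hff : FunctoriallyFinite X)
    (hext : ∀ x ∈ X, ∀ x' ∈ X, ∀ i : ℕ, 0 < i → i < d →
      Subsingleton (CategoryTheory.Abelian.Ext x x' i))
    (hcondA : ∀ (Y : ℕ → A) (g : ∀ i, Y (i + 1) ⟶ Y i),
      (∀ i, 1 ≤ i → i ≤ d → Y i ∈ X) →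
      Epi (g 0) → Mono (g d) →
      (∀ i < d, ∃ w : g (i + 1) ≫ g i = 0, (ShortComplex.mk (g (i + 1)) (g i) w).Exact) →
      (∀ i < d, ∀ ⦃t : A⦄, t ∈ X → ∀ l : t ⟶ image (g i),
        ∃ m : t ⟶ Y (i + 1), m ≫ factorThruImage (g i) = l) →
      ∀ ⦃t : A⦄, t ∈ X → ∀ h : Y (d + 1) ⟶ t, ∃ k : Y d ⟶ t, g d ≫ k = h) :
    ∀ M : A, (∀ x ∈ X, ∀ i : ℕ, 0 < i → i < d →
        Subsingleton (CategoryTheory.Abelian.Ext x M i)) →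
      ∀ x ∈ X, Subsingleton (CategoryTheory.Abelian.Ext M x 1) := by
  intro M hM x hx
  obtain ⟨P, p, hp⟩ := hff.1 M
  have : Epi p := by
    obtain ⟨y, hy, q, hq⟩ := hgen M
    obtain ⟨k, rfl⟩ := hp.2 hy q
    exact epi_of_epi k p
  have hS : (ShortComplex.mk (kernel.ι p) p (kernel.condition p)).ShortExact :=
    { exact := ShortComplex.exact_of_f_is_kernel _ (kernelIsKernel p) }
  obtain ⟨n, rfl⟩ : ∃ n, d = n + 1 := ⟨d - 1, by lia⟩
  obtain ⟨Y, g, h, -, hl⟩ := exists_isApproxResolution hcog hext hM p hp n (Nat.lt_succ_self n)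
  exact subsingleton_ext_one_of_extends hS (hext P hp.1 x hx 1 one_pos hd)
    (hl x (hcondA Y g h.mem h.epi h.mono h.exact h.approx hx))
end
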